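/- Let N ≥ 3, write N = 2n or N = 2n+1, and let p > q > 0 with p + q = N. With indices I_N = {-n,…,-1,(0),1,…,n}, θ_{ij} = 1, P = Σ E_{ij}⊗E_{ji}, Q = Σ E_{ij}⊗E_{-i,-j}, κ = N/2 − 1, R(u) = I − P/u + Q/(u−κ), let 𝒢 be the matrix of the symmetric pair of type BDI, (so_N, so_p ⊕ so_q): for N even, 𝒢 = Σ_{i=1}^{(p−q)/2}(E_{ii}+E_{-i,-i}) + Σ_{i=(p−q)/2+1}^{N/2}(E_{-i,i}+E_{i,-i}); for N odd, 𝒢 = Σ_{i=-(p−q−1)/2}^{(p−q−1)/2} E_{ii} + Σ_{i=(p−q+1)/2}^{(N−1)/2}(E_{-i,i}+E_{i,-i}). Set c = 4/(p−q) and K(u) = (I − cu𝒢)(1−cu)^{−1}. Then K(u) is a solution of the reflection equation: as an identity of rational functions in u,v, R(u−v) K₁(u) R(u+v) K₂(v) = K₂(v) R(u+v) K₁(u) R(u−v) in End(ℂ^N⊗ℂ^N), where K₁(u) = K(u)⊗I and K₂(v) = I⊗K(v). -/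

import Mathlib

open Matrix Kronecker Finset

noncomputable section

/-- The index set `I_N` as a subtype of `ℤ` determined by a finite set `S ⊆ ℤ`. -/
abbrev Idx (S : Finset ℤ) : Type := {i : ℤ // i ∈ S}

/-- The matrix unit `E_{ab}` of `End(ℂ^N)` (zero if `a` or `b` is not in the index set). -/
def Emat (S : Finset ℤ) (a b : ℤ) : Matrix (Idx S) (Idx S) ℂ :=
  fun p q => if ((p : ℤ) = a ∧ (q : ℤ) = b) then 1 else 0

/-- The permutation operator `P = Σ_{i,j} E_{ij} ⊗ E_{ji}` on `ℂ^N ⊗ ℂ^N`. -/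
def Pmat (S : Finset ℤ) : Matrix (Idx S × Idx S) (Idx S × Idx S) ℂ :=
  ∑ i ∈ S, ∑ j ∈ S, Emat S i j ⊗ₖ Emat S j i

/-- The operator `Q = Σ_{i,j} θ_{ij} E_{ij} ⊗ E_{-i,-j}` on `ℂ^N ⊗ ℂ^N`. -/
def Qmat (S : Finset ℤ) (θ : ℤ → ℤ → ℂ) : Matrix (Idx S × Idx S) (Idx S × Idx S) ℂ :=
  ∑ i ∈ S, ∑ j ∈ S, θ i j • (Emat S i j ⊗ₖ Emat S (-i) (-j))

/-- The R-matrix `R(u) = I - P/u + Q/(u - κ)` of types B, C, D. -/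
def Rmat (S : Finset ℤ) (θ : ℤ → ℤ → ℂ) (κ u : ℂ) :
    Matrix (Idx S × Idx S) (Idx S × Idx S) ℂ :=
  1 - u⁻¹ • Pmat S + (u - κ)⁻¹ • Qmat S θ

/-- `θ_{ij} = 1` (orthogonal case). -/
def θorth : ℤ → ℤ → ℂ := fun _ _ => 1

/-- `θ_{ij} = sign(i)·sign(j)` (symplectic case). -/
def θsymp : ℤ → ℤ → ℂ := fun i j =>
  (if 0 < i then (1 : ℂ) else -1) * (if 0 < j then (1 : ℂ) else -1)

/-- The K-matrix `K(u) = (I - c·u·𝒢)(1 - c·u)⁻¹`. -/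
def Kmat (S : Finset ℤ) (c : ℂ) (G : Matrix (Idx S) (Idx S) ℂ) (u : ℂ) :
    Matrix (Idx S) (Idx S) ℂ :=
  (1 - c * u)⁻¹ • ((1 : Matrix (Idx S) (Idx S) ℂ) - (c * u) • G)

/-- The reflection equation in an algebra with Brauer-type relations between `P`, `Q` and a pair
of commuting involutions `A = 𝒢₁`, `B = 𝒢₂`. -/
theorem reflection_of_relations {R : Type*} [Ring R] [Algebra ℂ R] {P Q A B : R} {M T : ℂ}
    (hPP : P * P = 1) (hPQ : P * Q = Q) (hQP : Q * P = Q) (hQQ : Q * Q = M • Q)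
    (hPA : P * A = B * P) (hPB : P * B = A * P) (hAA : A * A = 1) (hBB : B * B = 1)
    (hBA : B * A = A * B) (hQB : Q * B = Q * A) (hBQ : B * Q = A * Q)
    (hQAQ : Q * (A * Q) = T • Q) {s t s' t' a b : ℂ} (hs : a * (s - s') = b * (s + s'))
    (ht : a * (t - t' + s * t' - t * s') + b * (t + t' - s * t' - t * s' + M * t * t')
      = a * b * T * t * t') :
    (1 - s • P + t • Q) * (1 - a • A) * (1 - s' • P + t' • Q) * (1 - b • B) =
      (1 - b • B) * (1 - s' • P + t' • Q) * (1 - a • A) * (1 - s • P + t • Q) := by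
  have assoc {x y z : R} (h : x * y = z) (w : R) : x * (y * w) = z * w := by
    rw [← mul_assoc, h]
  have hQAB : Q * (A * B) = Q := by
    rw [← hBA, ← mul_assoc, hQB, mul_assoc, hAA, mul_one]
  have hQAP : Q * (A * P) = Q * A := by
    rw [← hPB, ← mul_assoc, hQP, hQB]
  simp only [mul_add, add_mul, mul_sub, sub_mul, smul_mul_assoc, mul_smul_comm, mul_one, one_mul,
    mul_assoc, hPP, hPQ, hQP, hQQ, hPA, hPB, hBB, hBA, hQB, hBQ, hQAQ, hQAB, hQAP,
    assoc hAA, assoc hBB, assoc hBA]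
  match_scalars <;> first
    | ring1
    | linear_combination hs
    | linear_combination -hs
    | linear_combination ht
    | linear_combination -ht

theorem Pmat_apply (S : Finset ℤ) (x y : Idx S × Idx S) :
    Pmat S x y = if x.1 = y.2 ∧ x.2 = y.1 then 1 else 0 := by
  obtain ⟨⟨a, ha⟩, ⟨b, hb⟩⟩ := x
  obtain ⟨⟨c, hc⟩, ⟨d, hd⟩⟩ := y
  simp only [Pmat, Matrix.sum_apply, kroneckerMap_apply, Emat, Subtype.mk.injEq]
  rw [Finset.sum_eq_single_of_mem a ha, Finset.sum_eq_single_of_mem c hc]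
  · simp [eq_comm, and_comm]
  · intro j _ hj
    simp [hj.symm]
  · intro i _ hi
    simp [hi.symm]

/-- The vector `Σ_i e_i ⊗ e_{-i}` spanning the image of `Q`. -/
def pairingVec (S : Finset ℤ) : Idx S × Idx S → ℂ :=
  fun x => if (x.2 : ℤ) = -x.1 then 1 else 0

theorem Qmat_θorth (S : Finset ℤ) :
    Qmat S θorth = vecMulVec (pairingVec S) (pairingVec S) := by
  ext ⟨⟨a, ha⟩, ⟨b, hb⟩⟩ ⟨⟨c, hc⟩, ⟨d, hd⟩⟩
  simp only [Qmat, θorth, one_smul, Matrix.sum_apply, kroneckerMap_apply, Emat, vecMulVec_apply,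
    pairingVec]
  rw [Finset.sum_eq_single_of_mem a ha, Finset.sum_eq_single_of_mem c hc]
  · simp only [ite_and]
    split_ifs <;> simp_all
  · intro j _ hj
    simp [hj.symm]
  · intro i _ hi
    simp [hi.symm]

theorem Pmat_mul_apply (S : Finset ℤ) (M : Matrix (Idx S × Idx S) (Idx S × Idx S) ℂ)
    (x y : Idx S × Idx S) : (Pmat S * M) x y = M x.swap y := by
  rw [Matrix.mul_apply, Finset.sum_eq_single x.swap]
  · simp [Pmat_apply]
  · intro z _ hz
    rw [Pmat_apply, if_neg, zero_mul]
    rintro ⟨h, h'⟩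
    exact hz (Prod.ext h'.symm h.symm)
  · simp

theorem mul_Pmat_apply (S : Finset ℤ) (M : Matrix (Idx S × Idx S) (Idx S × Idx S) ℂ)
    (x y : Idx S × Idx S) : (M * Pmat S) x y = M x y.swap := by
  rw [Matrix.mul_apply, Finset.sum_eq_single y.swap]
  · simp [Pmat_apply]
  · intro z _ hz
    rw [Pmat_apply, if_neg, mul_zero]
    rintro ⟨h, h'⟩
    exact hz (Prod.ext h h')
  · simp

theorem Pmat_mul_Pmat (S : Finset ℤ) : Pmat S * Pmat S = 1 := by
  ext x y
  simp [Pmat_mul_apply, Pmat_apply, Matrix.one_apply, Prod.ext_iff, and_comm]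

theorem pairingVec_swap (S : Finset ℤ) (x : Idx S × Idx S) :
    pairingVec S x.swap = pairingVec S x := by
  simp only [pairingVec, Prod.fst_swap, Prod.snd_swap]
  exact if_congr (by omega) rfl rfl

theorem Pmat_mul_Qmat (S : Finset ℤ) : Pmat S * Qmat S θorth = Qmat S θorth := by
  ext x y
  simp [Pmat_mul_apply, Qmat_θorth, vecMulVec_apply, pairingVec_swap]

theorem Qmat_mul_Pmat (S : Finset ℤ) : Qmat S θorth * Pmat S = Qmat S θorth := by
  ext x y
  simp [mul_Pmat_apply, Qmat_θorth, vecMulVec_apply, pairingVec_swap]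

theorem Pmat_mul_kronecker (S : Finset ℤ) (A B : Matrix (Idx S) (Idx S) ℂ) :
    Pmat S * (A ⊗ₖ B) = (B ⊗ₖ A) * Pmat S := by
  ext x y
  simp [Pmat_mul_apply, mul_Pmat_apply, mul_comm]

theorem sum_mul_pairingVec {S : Finset ℤ} (hS : ∀ i ∈ S, -i ∈ S) (f : Idx S × Idx S → ℂ) :
    ∑ x, f x * pairingVec S x = ∑ i : Idx S, f (i, ⟨-i, hS i i.2⟩) := by
  rw [Fintype.sum_prod_type]
  refine Finset.sum_congr rfl fun i _ => ?_
  rw [Finset.sum_eq_single ⟨-i, hS i i.2⟩]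
  · simp [pairingVec]
  · intro j _ hj
    rw [pairingVec, if_neg, mul_zero]
    exact fun h => hj (Subtype.ext h)
  · simp

theorem Qmat_mul_kronecker_mul_Qmat {S : Finset ℤ} (hS : ∀ i ∈ S, -i ∈ S)
    (A : Matrix (Idx S) (Idx S) ℂ) :
    Qmat S θorth * ((A ⊗ₖ (1 : Matrix (Idx S) (Idx S) ℂ)) * Qmat S θorth) =
      A.trace • Qmat S θorth := by
  rw [Qmat_θorth, mul_vecMulVec, vecMulVec_mul_vecMulVec, vecMulVec_smul, dotProduct_comm]
  congr 1
  simp only [dotProduct]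
  rw [sum_mul_pairingVec hS, trace]
  refine Finset.sum_congr rfl fun i _ => ?_
  rw [mulVec, dotProduct, sum_mul_pairingVec hS, Finset.sum_eq_single i]
  · simp
  · intro j _ hj
    simp [Subtype.ext_iff, (Subtype.coe_ne_coe.mpr hj).symm]
  · simp

/-- The permutation `i ↦ i` for `|i| ≤ m` and `i ↦ -i` otherwise, as a matrix. -/
def flipMat (S : Finset ℤ) (m : ℤ) : Matrix (Idx S) (Idx S) ℂ :=
  fun i j => if (j : ℤ) = if |(i : ℤ)| ≤ m then (i : ℤ) else -i then 1 else 0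

theorem flipMat_mul_self {S : Finset ℤ} (hS : ∀ i ∈ S, -i ∈ S) (m : ℤ) :
    flipMat S m * flipMat S m = 1 := by
  ext ⟨i, hi⟩ ⟨j, hj⟩
  rw [Matrix.mul_apply, Finset.sum_eq_single ⟨if |i| ≤ m then i else -i, by
    split_ifs
    exacts [hi, hS i hi]⟩]
  · by_cases h : |i| ≤ m <;> simp [flipMat, h, Matrix.one_apply, eq_comm]
  · intro k _ hk
    rw [flipMat, if_neg, zero_mul]
    exact fun h => hk (Subtype.ext h)
  · simp

/-- `flipMat` is fixed by the transposition `E_{ij} ↦ E_{-j,-i}`. -/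
theorem flipMat_neg_neg {S : Finset ℤ} (m : ℤ) {i i' j j' : Idx S} (hi : (i' : ℤ) = -i)
    (hj : (j' : ℤ) = -j) : flipMat S m j' i' = flipMat S m i j := by
  simp only [flipMat, hi, hj, abs_neg]
  refine if_congr ?_ rfl rfl
  split_ifs <;> grind

theorem flipMat_comm {S : Finset ℤ} (m : ℤ) (i j : Idx S) :
    flipMat S m j i = flipMat S m i j := by
  simp only [flipMat]
  refine if_congr ?_ rfl rfl
  split_ifs <;> grind

theorem kronecker_one_mulVec_pairingVec {S : Finset ℤ} (hS : ∀ i ∈ S, -i ∈ S)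
    (A : Matrix (Idx S) (Idx S) ℂ) (i j : Idx S) :
    ((A ⊗ₖ (1 : Matrix (Idx S) (Idx S) ℂ)) *ᵥ pairingVec S) (i, j) = A i ⟨-j, hS j j.2⟩ := by
  rw [mulVec, dotProduct, sum_mul_pairingVec hS, Finset.sum_eq_single ⟨-j, hS j j.2⟩]
  · simp
  · intro k _ hk
    have : (j : ℤ) ≠ -k := fun h => hk (Subtype.ext (by simp [h]))
    simp [Subtype.ext_iff, this]
  · simp

theorem one_kronecker_mulVec_pairingVec {S : Finset ℤ} (hS : ∀ i ∈ S, -i ∈ S)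
    (A : Matrix (Idx S) (Idx S) ℂ) (i j : Idx S) :
    (((1 : Matrix (Idx S) (Idx S) ℂ) ⊗ₖ A) *ᵥ pairingVec S) (i, j) = A j ⟨-i, hS i i.2⟩ := by
  rw [mulVec, dotProduct, sum_mul_pairingVec hS, Finset.sum_eq_single i]
  · simp
  · intro k _ hk
    simp [hk.symm]
  · simp

theorem flipMat_mulVec_pairingVec {S : Finset ℤ} (hS : ∀ i ∈ S, -i ∈ S) (m : ℤ) :
    ((1 : Matrix (Idx S) (Idx S) ℂ) ⊗ₖ flipMat S m) *ᵥ pairingVec S =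
      (flipMat S m ⊗ₖ (1 : Matrix (Idx S) (Idx S) ℂ)) *ᵥ pairingVec S := by
  ext ⟨i, j⟩
  rw [kronecker_one_mulVec_pairingVec hS, one_kronecker_mulVec_pairingVec hS]
  exact flipMat_neg_neg m rfl (by simp)

theorem flipMat_transpose (S : Finset ℤ) (m : ℤ) : (flipMat S m)ᵀ = flipMat S m := by
  ext i j
  exact flipMat_comm m i j

theorem pairingVec_vecMul_flipMat {S : Finset ℤ} (hS : ∀ i ∈ S, -i ∈ S) (m : ℤ) :
    pairingVec S ᵥ* ((1 : Matrix (Idx S) (Idx S) ℂ) ⊗ₖ flipMat S m) =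
      pairingVec S ᵥ* (flipMat S m ⊗ₖ (1 : Matrix (Idx S) (Idx S) ℂ)) := by
  rw [← mulVec_transpose, ← mulVec_transpose, ← kroneckerMap_transpose, ← kroneckerMap_transpose,
    flipMat_transpose, transpose_one, flipMat_mulVec_pairingVec hS]

theorem Kmat_kronecker_one (S : Finset ℤ) (c u : ℂ) (G : Matrix (Idx S) (Idx S) ℂ) :
    Kmat S c G u ⊗ₖ (1 : Matrix (Idx S) (Idx S) ℂ) =
      (1 - c * u)⁻¹ • (1 - (c * u) • (G ⊗ₖ (1 : Matrix (Idx S) (Idx S) ℂ))) := by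
  simp only [Kmat, sub_eq_add_neg, ← neg_smul, smul_kronecker, add_kronecker, one_kronecker_one]

theorem one_kronecker_Kmat (S : Finset ℤ) (c u : ℂ) (G : Matrix (Idx S) (Idx S) ℂ) :
    (1 : Matrix (Idx S) (Idx S) ℂ) ⊗ₖ Kmat S c G u =
      (1 - c * u)⁻¹ • (1 - (c * u) • ((1 : Matrix (Idx S) (Idx S) ℂ) ⊗ₖ G)) := by
  simp only [Kmat, sub_eq_add_neg, ← neg_smul, kronecker_smul, kronecker_add, one_kronecker_one]

theorem reflection_flipMat {S : Finset ℤ} (hS : ∀ i ∈ S, -i ∈ S) (m : ℤ) {κ c u v : ℂ}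
    (hκ : κ = (#S : ℂ) / 2 - 1) (hc : c * (flipMat S m).trace = 4)
    (h1 : u - v ≠ 0) (h2 : u - v ≠ κ) (h3 : u + v ≠ 0) (h4 : u + v ≠ κ) :
    Rmat S θorth κ (u - v) * (Kmat S c (flipMat S m) u ⊗ₖ (1 : Matrix (Idx S) (Idx S) ℂ)) *
        Rmat S θorth κ (u + v) * ((1 : Matrix (Idx S) (Idx S) ℂ) ⊗ₖ Kmat S c (flipMat S m) v) =
      ((1 : Matrix (Idx S) (Idx S) ℂ) ⊗ₖ Kmat S c (flipMat S m) v) * Rmat S θorth κ (u + v) *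
        (Kmat S c (flipMat S m) u ⊗ₖ (1 : Matrix (Idx S) (Idx S) ℂ)) *
        Rmat S θorth κ (u - v) := by
  have hQQ := Qmat_mul_kronecker_mul_Qmat hS 1
  rw [one_kronecker_one, one_mul, trace_one, Fintype.card_coe] at hQQ
  have key := reflection_of_relations (Pmat_mul_Pmat S) (Pmat_mul_Qmat S) (Qmat_mul_Pmat S) hQQ
    (Pmat_mul_kronecker S (flipMat S m) 1) (Pmat_mul_kronecker S 1 (flipMat S m))
    (by rw [← mul_kronecker_mul, flipMat_mul_self hS, one_mul, one_kronecker_one])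
    (by rw [← mul_kronecker_mul, flipMat_mul_self hS, one_mul, one_kronecker_one])
    (by rw [← mul_kronecker_mul, ← mul_kronecker_mul, one_mul, mul_one])
    (by rw [Qmat_θorth, vecMulVec_mul, vecMulVec_mul, pairingVec_vecMul_flipMat hS])
    (by rw [Qmat_θorth, mul_vecMulVec, mul_vecMulVec, flipMat_mulVec_pairingVec hS])
    (Qmat_mul_kronecker_mul_Qmat hS (flipMat S m))
    (s := (u - v)⁻¹) (t := (u - v - κ)⁻¹) (s' := (u + v)⁻¹) (t' := (u + v - κ)⁻¹)
    (a := c * u) (b := c * v) (by field_simp; ring) (by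
      have hS' : (#S : ℂ) = 2 * κ + 2 := by rw [hκ]; ring
      rw [hS']
      have h2' := sub_ne_zero.mpr h2
      have h4' := sub_ne_zero.mpr h4
      generalize (flipMat S m).trace = T at hc
      have hT : c * u * (c * v) * T * (u - v - κ)⁻¹ * (u + v - κ)⁻¹ =
          4 * c * u * v * (u - v - κ)⁻¹ * (u + v - κ)⁻¹ := by
        linear_combination c * u * v * (u - v - κ)⁻¹ * (u + v - κ)⁻¹ * hc
      rw [hT]
      field_simp
      ring)
  rw [Kmat_kronecker_one, one_kronecker_Kmat]
  simp only [Rmat, mul_smul_comm, smul_mul_assoc, key]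
  rw [smul_comm]

theorem trace_flipMat {S : Finset ℤ} {m : ℤ} (hm : 0 ∈ S → 0 ≤ m) :
    (flipMat S m).trace = #{i ∈ S | |i| ≤ m} := by
  rw [trace, ← Finset.sum_boole, ← Finset.sum_coe_sort S]
  refine Finset.sum_congr rfl fun i _ => ?_
  simp only [Matrix.diag, flipMat]
  refine if_congr ?_ rfl rfl
  have : (i : ℤ) = 0 → 0 ≤ m := fun h => hm (h ▸ i.2)
  grind

theorem sum_Emat_apply {S T : Finset ℤ} {f g : ℤ → ℤ} {i j : Idx S} {k₀ : ℤ} {C : Prop}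
    [Decidable C] (h : ∀ k, ((i : ℤ) = f k ∧ (j : ℤ) = g k) ↔ (k = k₀ ∧ C)) :
    (∑ k ∈ T, Emat S (f k) (g k)) i j = if k₀ ∈ T ∧ C then 1 else 0 := by
  simp only [Matrix.sum_apply, Emat, h, ite_and, Finset.sum_ite_eq']

theorem sum_Emat_self_self {S T : Finset ℤ} (i j : Idx S) :
    (∑ k ∈ T, Emat S k k) i j = if (i : ℤ) ∈ T ∧ (j : ℤ) = i then 1 else 0 :=
  sum_Emat_apply (by omega)

theorem sum_Emat_neg_neg {S T : Finset ℤ} (i j : Idx S) :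
    (∑ k ∈ T, Emat S (-k) (-k)) i j = if -(i : ℤ) ∈ T ∧ (j : ℤ) = i then 1 else 0 :=
  sum_Emat_apply (by omega)

theorem sum_Emat_neg_self {S T : Finset ℤ} (i j : Idx S) :
    (∑ k ∈ T, Emat S (-k) k) i j = if (j : ℤ) ∈ T ∧ (i : ℤ) = -j then 1 else 0 :=
  sum_Emat_apply (by omega)

theorem sum_Emat_self_neg {S T : Finset ℤ} (i j : Idx S) :
    (∑ k ∈ T, Emat S k (-k)) i j = if (i : ℤ) ∈ T ∧ (j : ℤ) = -i then 1 else 0 :=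
  sum_Emat_apply (by omega)

theorem sum_Emat_eq_flipMat_erase (n : ℤ) {m : ℤ} (hm : 0 ≤ m) :
    ∑ i ∈ Icc 1 m, (Emat ((Icc (-n) n).erase 0) i i + Emat ((Icc (-n) n).erase 0) (-i) (-i)) +
      ∑ i ∈ Icc (m + 1) n,
        (Emat ((Icc (-n) n).erase 0) (-i) i + Emat ((Icc (-n) n).erase 0) i (-i)) =
      flipMat ((Icc (-n) n).erase 0) m := by
  ext i j
  have hi := i.2
  rw [mem_erase, mem_Icc] at hi
  simp only [sum_add_distrib, Matrix.add_apply, sum_Emat_self_self, sum_Emat_neg_neg,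
    sum_Emat_neg_self, sum_Emat_self_neg, flipMat, mem_Icc, abs_le]
  split_ifs <;> first | (exfalso; omega) | norm_num

theorem sum_Emat_eq_flipMat_Icc (n : ℤ) {m : ℤ} (hm : 0 ≤ m) :
    ∑ i ∈ Icc (-m) m, Emat (Icc (-n) n) i i +
      ∑ i ∈ Icc (m + 1) n, (Emat (Icc (-n) n) (-i) i + Emat (Icc (-n) n) i (-i)) =
      flipMat (Icc (-n) n) m := by
  ext i j
  have hi := i.2
  rw [mem_Icc] at hi
  simp only [sum_add_distrib, Matrix.add_apply, sum_Emat_self_self,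
    sum_Emat_neg_self, sum_Emat_self_neg, flipMat, mem_Icc, abs_le]
  split_ifs <;> first | (exfalso; omega) | norm_num

theorem card_erase_filter {n m : ℤ} (hm : 0 ≤ m) (hmn : m ≤ n) :
    (#{i ∈ (Icc (-n) n).erase 0 | |i| ≤ m} : ℤ) = 2 * m := by
  have : {i ∈ (Icc (-n) n).erase 0 | |i| ≤ m} = (Icc (-m) m).erase 0 := by
    ext i
    simp only [mem_filter, mem_erase, mem_Icc, abs_le]
    omega
  rw [this, card_erase_of_mem (by simp [hm]), Int.card_Icc]
  omega

theorem card_Icc_filter {n m : ℤ} (hm : 0 ≤ m) (hmn : m ≤ n) :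
    (#{i ∈ Icc (-n) n | |i| ≤ m} : ℤ) = 2 * m + 1 := by
  have : {i ∈ Icc (-n) n | |i| ≤ m} = Icc (-m) m := by
    ext i
    simp only [mem_filter, mem_Icc, abs_le]
    omega
  rw [this, Int.card_Icc]
  omega

/-- the K-matrix `K(u) = (I - c·u·𝒢)(1 - c·u)⁻¹`, `c = 4/(p-q)`, of type BDI
(symmetric pair `(so_N, so_p ⊕ so_q)`, `p > q > 0`, `p + q = N`) solves the reflection
equation for the orthogonal R-matrix (`κ = N/2 - 1`). -/
theorem reflection_BDI (N n p q : ℕ) (hN : 3 ≤ N) (hpar : N = 2 * n ∨ N = 2 * n + 1)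
    (hq : 0 < q) (hpq : q < p) (hsum : p + q = N)
    (S : Finset ℤ)
    (hS : S = if N = 2 * n then (Finset.Icc (-(n : ℤ)) (n : ℤ)).erase 0
              else Finset.Icc (-(n : ℤ)) (n : ℤ))
    (κ : ℂ) (hκ : κ = (N : ℂ) / 2 - 1)
    (c : ℂ) (hc : c = 4 / ((p : ℂ) - (q : ℂ)))
    (G : Matrix (Idx S) (Idx S) ℂ)
    (hG : G = if N = 2 * n then
            (∑ i ∈ Finset.Icc (1 : ℤ) (((p : ℤ) - (q : ℤ)) / 2),
                (Emat S i i + Emat S (-i) (-i)))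
              + ∑ i ∈ Finset.Icc ((((p : ℤ) - (q : ℤ)) / 2) + 1) ((N : ℤ) / 2),
                  (Emat S (-i) i + Emat S i (-i))
          else
            (∑ i ∈ Finset.Icc (-(((p : ℤ) - (q : ℤ) - 1) / 2)) (((p : ℤ) - (q : ℤ) - 1) / 2),
                Emat S i i)
              + ∑ i ∈ Finset.Icc (((p : ℤ) - (q : ℤ) + 1) / 2) (((N : ℤ) - 1) / 2),
                  (Emat S (-i) i + Emat S i (-i)))
    (u v : ℂ) (h1 : u - v ≠ 0) (h2 : u - v ≠ κ) (h3 : u + v ≠ 0) (h4 : u + v ≠ κ)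
    (h5 : c * u ≠ 1) (h6 : c * v ≠ 1) :
    Rmat S θorth κ (u - v) * (Kmat S c G u ⊗ₖ (1 : Matrix (Idx S) (Idx S) ℂ)) *
        Rmat S θorth κ (u + v) * ((1 : Matrix (Idx S) (Idx S) ℂ) ⊗ₖ Kmat S c G v) =
      ((1 : Matrix (Idx S) (Idx S) ℂ) ⊗ₖ Kmat S c G v) * Rmat S θorth κ (u + v) *
        (Kmat S c G u ⊗ₖ (1 : Matrix (Idx S) (Idx S) ℂ)) * Rmat S θorth κ (u - v) := by
  have hpq' : (p : ℂ) - q ≠ 0 := by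
    rw [sub_ne_zero]
    exact_mod_cast hpq.ne'
  obtain ⟨m, hm0, hS', hcard, hcard', hG'⟩ : ∃ m : ℤ, (0 ∈ S → 0 ≤ m) ∧
      (∀ i ∈ S, -i ∈ S) ∧ #S = N ∧ (#{i ∈ S | |i| ≤ m} : ℤ) = p - q ∧ G = flipMat S m := by
    rcases hpar with h | h
    · obtain ⟨d, hd⟩ : ∃ d : ℤ, (p : ℤ) - q = 2 * d := ⟨n - q, by omega⟩
      have e₁ : ((p : ℤ) - q) / 2 = d := by omega
      have e₂ : (N : ℤ) / 2 = n := by omega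
      rw [if_pos h] at hS hG
      subst hS
      rw [e₁, e₂, sum_Emat_eq_flipMat_erase _ (by omega)] at hG
      refine ⟨d, by simp, fun i hi => ?_, ?_, ?_, hG⟩
      · simp only [mem_erase, mem_Icc] at hi ⊢
        omega
      · rw [card_erase_of_mem (by simp), Int.card_Icc]
        omega
      · rw [card_erase_filter (by omega) (by omega), hd]
    · obtain ⟨d, hd⟩ : ∃ d : ℤ, (p : ℤ) - q = 2 * d + 1 := ⟨n - q, by omega⟩
      have e₁ : ((p : ℤ) - q - 1) / 2 = d := by omega
      have e₂ : ((p : ℤ) - q + 1) / 2 = d + 1 := by omega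
      have e₃ : ((N : ℤ) - 1) / 2 = n := by omega
      rw [if_neg (by omega)] at hS hG
      subst hS
      rw [e₁, e₂, e₃, sum_Emat_eq_flipMat_Icc _ (by omega)] at hG
      refine ⟨d, fun _ => by omega, fun i hi => ?_, ?_, ?_, hG⟩
      · simp only [mem_Icc] at hi ⊢
        omega
      · rw [Int.card_Icc]
        omega
      · rw [card_Icc_filter (by omega) (by omega), hd]
  subst hG'
  refine reflection_flipMat hS' m (by rw [hκ, hcard]) ?_ h1 h2 h3 h4
  have hT : (#{i ∈ S | |i| ≤ m} : ℂ) = p - q := by exact_mod_cast hcard'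
  rw [trace_flipMat hm0, hT, hc, div_mul_cancel₀ _ hpq']
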